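/- Set s_{ij} = 1 if μ + r_i − r_j ≥ 0 and s_{ij} = δ^{r_j − r_i − μ} otherwise, L = Σ_{i,j=1}^n m_j (β_i η_{ij} s_{ij} + m_i ψ_{ij}), and H_2 = (min{w_0/(4hL), w_1/(2hL), w_2/(2L)})^{1/μ}. If 0 < δ < H_2, then c_0 := w_0 − 4hLδ^μ > 0, c_1 := w_1 − 2hLδ^μ > 0, c_2 := w_2 − 2Lδ^μ > 0, and for every solution x(·) of the delay system ẋ(t) = f(x(t), x(t−h)) and every t ≥ 0 such that ‖x_t‖_H ≤ δ, the function s ↦ v(x_s) is differentiable at t with d/dt v(x_t) ≤ −c_0 ‖x(t)‖_{r,p}^{γ+μ} − c_1 ‖x(t−h)‖_{r,p}^{γ+μ} − c_2 ∫_{−h}^{0} ‖x(t+θ)‖_{r,p}^{γ+μ} dθ. -/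

import Mathlib

set_option linter.unusedVariables false

noncomputable def hnorm (n : ℕ) (r : Fin n → ℝ) (p : ℝ) (x : Fin n → ℝ) : ℝ :=
  (∑ i, |x i| ^ (p / r i)) ^ (1 / p)

noncomputable def pd (n : ℕ) (f : (Fin n → ℝ) → (Fin n → ℝ) → (Fin n → ℝ))
    (i j : Fin n) (x y : Fin n → ℝ) : ℝ :=
  deriv (fun t => f (Function.update x j t) y i) (x j)

noncomputable def vfun (n : ℕ) (r : Fin n → ℝ) (p h μ γ w1 w2 : ℝ)
    (f : (Fin n → ℝ) → (Fin n → ℝ) → (Fin n → ℝ)) (V : (Fin n → ℝ) → ℝ)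
    (φ : ℝ → Fin n → ℝ) : ℝ :=
  V (φ 0) + fderiv ℝ V (φ 0) (∫ θ in (-h)..(0:ℝ), f (φ 0) (φ θ))
    + ∫ θ in (-h)..(0:ℝ), (w1 + (h + θ) * w2) * hnorm n r p (φ θ) ^ (γ + μ)

noncomputable def segNorm (n : ℕ) (r : Fin n → ℝ) (p h : ℝ)
    (x : ℝ → Fin n → ℝ) (t : ℝ) : ℝ :=
  sSup ((fun θ => hnorm n r p (x (t + θ))) '' Set.Icc (-h) 0)

def IsSol (n : ℕ) (h : ℝ) (f : (Fin n → ℝ) → (Fin n → ℝ) → (Fin n → ℝ))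
    (x : ℝ → Fin n → ℝ) : Prop :=
  ContinuousOn x (Set.Ici (-h)) ∧
  ∀ t : ℝ, 0 ≤ t → HasDerivWithinAt x (f (x t) (x (t - h))) (Set.Ici 0) t

theorem mul_rpow_le_of_le {a b z M δ A B C g d : ℝ} (ha : 0 ≤ a) (hb : 0 ≤ b) (hz : 0 ≤ z)
    (haM : a ≤ M) (hbM : b ≤ M) (hzM : z ≤ M) (hM : M ≤ δ) (hA : 0 ≤ A) (hB : 0 ≤ B)
    (hC : 0 ≤ C) (hg : 0 ≤ g) (hd : 0 ≤ d) (hs : A + B + C = g + d) :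
    a ^ A * z ^ B * b ^ C ≤ δ ^ d * M ^ g := by
  have hM0 : 0 ≤ M := ha.trans haM
  calc a ^ A * z ^ B * b ^ C ≤ M ^ A * M ^ B * M ^ C := by gcongr
    _ = M ^ d * M ^ g := by
      rw [← Real.rpow_add_of_nonneg hM0 hA hB, ← Real.rpow_add_of_nonneg hM0 (by positivity) hC,
        hs, Real.rpow_add_of_nonneg hM0 hg hd, mul_comm]
    _ ≤ δ ^ d * M ^ g := by gcongr

theorem max_rpow_le_add {a b g : ℝ} (ha : 0 ≤ a) (hb : 0 ≤ b) :
    (max a b) ^ g ≤ a ^ g + b ^ g := by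
  have := Real.rpow_nonneg ha g
  have := Real.rpow_nonneg hb g
  rcases max_choice a b with h | h <;> rw [h] <;> linarith

theorem rpow_mul_add_mul_add_le {a b z δ A B C g d : ℝ} (ha : 0 ≤ a) (hb : 0 ≤ b) (hz : 0 ≤ z)
    (haδ : a ≤ δ) (hbδ : b ≤ δ) (hzδ : z ≤ δ) (hA : 0 ≤ A) (hB : 0 ≤ B)
    (hC : 0 ≤ C) (hg : 0 ≤ g) (hd : 0 ≤ d) (hs : A + B + C = g + d) :
    a ^ A * (a ^ B + z ^ B) * (a ^ C + b ^ C) ≤ δ ^ d * (4 * a ^ g + 2 * b ^ g + 2 * z ^ g) := by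
  have hδd : 0 ≤ δ ^ d := Real.rpow_nonneg (ha.trans haδ) d
  have h1 := mul_rpow_le_of_le ha ha ha le_rfl le_rfl le_rfl haδ hA hB hC hg hd hs
  have h2 := mul_rpow_le_of_le ha hb ha (le_max_left a b) (le_max_right a b) (le_max_left a b)
    (max_le haδ hbδ) hA hB hC hg hd hs
  have h3 := mul_rpow_le_of_le ha ha hz (le_max_left a z) (le_max_left a z) (le_max_right a z)
    (max_le haδ hzδ) hA hB hC hg hd hs
  have h4 := mul_rpow_le_of_le ha hb hz ((le_max_left a b).trans (le_max_left _ z))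
    ((le_max_right a b).trans (le_max_left _ z)) (le_max_right _ z)
    (max_le (max_le haδ hbδ) hzδ) hA hB hC hg hd hs
  have k2 := mul_le_mul_of_nonneg_left (max_rpow_le_add (g := g) ha hb) hδd
  have k3 := mul_le_mul_of_nonneg_left (max_rpow_le_add (g := g) ha hz) hδd
  have k4 := mul_le_mul_of_nonneg_left ((max_rpow_le_add (g := g) (le_max_of_le_left ha) hz).trans
    (add_le_add_left (max_rpow_le_add (g := g) ha hb) _)) hδd
  linarith

theorem hnorm_nonneg {n : ℕ} (r : Fin n → ℝ) (p : ℝ) (x : Fin n → ℝ) : 0 ≤ hnorm n r p x := by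
  unfold hnorm; positivity

theorem continuous_hnorm {n : ℕ} {r : Fin n → ℝ} (hr : ∀ i, 0 < r i) {p : ℝ} (hp : 0 < p) :
    Continuous (hnorm n r p) := by
  unfold hnorm
  refine Continuous.rpow_const ?_ fun _ => Or.inr (by positivity)
  refine continuous_finsetSum _ fun i _ => ?_
  exact (continuous_apply i).abs.rpow_const fun _ => Or.inr (div_pos hp (hr i)).le

theorem pd_eq_fderiv {n : ℕ} {f : (Fin n → ℝ) → (Fin n → ℝ) → (Fin n → ℝ)} {y z : Fin n → ℝ}
    (hd : DifferentiableAt ℝ (fun x => f x y) z) (i j : Fin n) :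
    pd n f i j z y = fderiv ℝ (fun x => f x y) z (Pi.single j 1) i := by
  have h1 : HasDerivAt (Function.update z j) (Pi.single j 1) (z j) := hasDerivAt_update z j (z j)
  have h2 : HasFDerivAt (fun x => f x y) (fderiv ℝ (fun x => f x y) z)
      (Function.update z j (z j)) := by
    rw [Function.update_eq_self]; exact hd.hasFDerivAt
  exact (hasDerivAt_pi.1 (h2.comp_hasDerivAt (z j) h1) i).deriv

theorem exists_norm_fderiv_le_of_pd_le {n : ℕ} {r : Fin n → ℝ} (hr : ∀ i, 0 < r i) {p : ℝ}
    (hp : 0 < p) {μ : ℝ} {f : (Fin n → ℝ) → (Fin n → ℝ) → (Fin n → ℝ)}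
    (hd : ∀ y, Differentiable ℝ fun x => f x y) {η : Fin n → Fin n → ℝ}
    (hfd1 : ∀ i j, 0 ≤ μ + r i - r j → ∀ x y : Fin n → ℝ,
      |pd n f i j x y| ≤ η i j * (hnorm n r p x ^ (μ + r i - r j) + hnorm n r p y ^ (μ + r i - r j)))
    (hfd2 : ∀ i j, μ + r i - r j < 0 → ∀ x y : Fin n → ℝ, |pd n f i j x y| ≤ η i j) (R : ℝ) :
    ∃ K : ℝ, ∀ y ∈ Metric.closedBall (0 : Fin n → ℝ) R,
      ∀ z ∈ Metric.closedBall (0 : Fin n → ℝ) R, ‖fderiv ℝ (fun z => f z y) z‖ ≤ K := by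
  have hpd : ∀ i j, ∃ C : ℝ, ∀ y ∈ Metric.closedBall (0 : Fin n → ℝ) R,
      ∀ z ∈ Metric.closedBall (0 : Fin n → ℝ) R, |pd n f i j z y| ≤ C := by
    intro i j
    rcases le_or_gt 0 (μ + r i - r j) with he | he
    · have hcont : Continuous fun q : (Fin n → ℝ) × (Fin n → ℝ) => η i j *
          (hnorm n r p q.1 ^ (μ + r i - r j) + hnorm n r p q.2 ^ (μ + r i - r j)) :=
        continuous_const.mul
          ((((continuous_hnorm hr hp).comp continuous_fst).rpow_const fun _ => Or.inr he).add
            (((continuous_hnorm hr hp).comp continuous_snd).rpow_const fun _ => Or.inr he))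
      obtain ⟨C, hC⟩ := ((isCompact_closedBall (0 : Fin n → ℝ) R).prod
        (isCompact_closedBall (0 : Fin n → ℝ) R)).exists_bound_of_continuousOn hcont.continuousOn
      exact ⟨C, fun y hy z hz => (hfd1 i j he z y).trans
        ((le_abs_self _).trans (hC (z, y) ⟨hz, hy⟩))⟩
    · exact ⟨η i j, fun y _ z _ => hfd2 i j he z y⟩
  choose C hC using hpd
  refine ⟨∑ j, ∑ i, |C i j|, fun y hy z hz => ?_⟩
  refine ContinuousLinearMap.opNorm_le_bound _ (by positivity) fun v => ?_
  conv_lhs => rw [pi_eq_sum_univ' v, map_sum]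
  rw [Finset.sum_mul]
  refine norm_sum_le_of_le _ fun j _ => ?_
  rw [map_smul, norm_smul, mul_comm]
  refine mul_le_mul ?_ (norm_le_pi_norm v j) (norm_nonneg _) (by positivity)
  refine (pi_norm_le_iff_of_nonneg (by positivity)).2 fun i => ?_
  rw [← pd_eq_fderiv (hd y z), Real.norm_eq_abs]
  refine ((hC i j y hy z hz).trans (le_abs_self _)).trans ?_
  exact Finset.single_le_sum (f := fun i => |C i j|) (fun _ _ => abs_nonneg _) (Finset.mem_univ i)

theorem continuous_uncurry_of_norm_fderiv_le {E F G : Type*} [NormedAddCommGroup E]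
    [NormedSpace ℝ E] [NormedAddCommGroup F] [NormedAddCommGroup G] [NormedSpace ℝ G]
    {f : E → F → G} (hd : ∀ y, Differentiable ℝ fun x => f x y) (hc : ∀ x, Continuous (f x))
    (hbd : ∀ R : ℝ, ∃ K : ℝ, ∀ y ∈ Metric.closedBall (0 : F) R,
      ∀ z ∈ Metric.closedBall (0 : E) R, ‖fderiv ℝ (fun z => f z y) z‖ ≤ K) :
    Continuous f.uncurry := by
  rw [continuous_iff_continuousAt]
  rintro ⟨x, y⟩
  set R := max ‖x‖ ‖y‖ + 1
  obtain ⟨K, hK⟩ := hbd R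
  have hon : ContinuousOn f.uncurry (Metric.closedBall 0 R ×ˢ Metric.closedBall 0 R) := by
    refine continuousOn_prod_of_continuousOn_lipschitzOnWith _ K.toNNReal
      (fun a _ => (hc a).continuousOn) fun b hb => ?_
    refine Convex.lipschitzOnWith_of_nnnorm_fderiv_le (𝕜 := ℝ) (fun z _ => hd b z) (fun z hz => ?_)
      (convex_closedBall 0 R)
    rw [← NNReal.coe_le_coe, coe_nnnorm]
    exact (hK b hb z hz).trans (Real.le_coe_toNNReal K)
  refine hon.continuousAt (prod_mem_nhds ?_ ?_) <;>
  refine Metric.closedBall_mem_nhds_of_mem ?_ <;>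
  rw [mem_ball_zero_iff]
  · exact (le_max_left _ _).trans_lt (lt_add_one _)
  · exact (le_max_right _ _).trans_lt (lt_add_one _)

theorem clm_apply_eq_sum {n : ℕ} (A : (Fin n → ℝ) →L[ℝ] ℝ) (v : Fin n → ℝ) :
    A v = ∑ i, v i * A (Pi.single i 1) := by
  conv_lhs => rw [pi_eq_sum_univ' v, map_sum]
  simp

theorem sum_remainder_le {n : ℕ} {r : Fin n → ℝ} (hr : ∀ i, 0 < r i) {μ γ δ : ℝ} (hμ : 0 < μ)
    (hγ : ∀ i, 2 * r i ≤ γ) (hδ : 0 < δ) {m β : Fin n → ℝ} {η ψ : Fin n → Fin n → ℝ}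
    (hm : ∀ i, 0 < m i) (hβ : ∀ i, 0 < β i) (hη : ∀ i j, 0 < η i j) (hψ : ∀ i j, 0 < ψ i j)
    {a b z : ℝ} (ha : 0 ≤ a) (hb : 0 ≤ b) (hz : 0 ≤ z) (haδ : a ≤ δ) (hbδ : b ≤ δ) (hzδ : z ≤ δ)
    {P u v : Fin n → ℝ} {G Q : Fin n → Fin n → ℝ}
    (hP : ∀ i, |P i| ≤ β i * a ^ (γ - r i))
    (hG1 : ∀ i j, 0 ≤ μ + r i - r j →
      |G i j| ≤ η i j * (a ^ (μ + r i - r j) + z ^ (μ + r i - r j)))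
    (hG2 : ∀ i j, μ + r i - r j < 0 → |G i j| ≤ η i j)
    (hu : ∀ i, |u i| ≤ m i * (a ^ (μ + r i) + z ^ (μ + r i)))
    (hv : ∀ j, |v j| ≤ m j * (a ^ (μ + r j) + b ^ (μ + r j)))
    (hQ : ∀ i j, |Q i j| ≤ ψ i j * a ^ (γ - r i - r j)) :
    ∑ i, ∑ j, (P i * G i j * v j + Q i j * u i * v j) ≤
      (∑ i, ∑ j, m j * (β i * η i j *
        (if 0 ≤ μ + r i - r j then 1 else δ ^ (r j - r i - μ)) + m i * ψ i j)) * δ ^ μ *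
        (4 * a ^ (γ + μ) + 2 * b ^ (γ + μ) + 2 * z ^ (γ + μ)) := by
  rw [mul_assoc, Finset.sum_mul]
  refine Finset.sum_le_sum fun i _ => ?_
  rw [Finset.sum_mul]
  refine Finset.sum_le_sum fun j _ => ?_
  have hri := hr i
  have hrj := hr j
  have hγi := hγ i
  have hγj := hγ j
  have hmi := hm i
  have hmj := hm j
  have hβi := hβ i
  have hηij := hη i j
  have hψij := hψ i j
  set T := 4 * a ^ (γ + μ) + 2 * b ^ (γ + μ) + 2 * z ^ (γ + μ) with hT
  have hQterm : Q i j * u i * v j ≤ m j * (m i * ψ i j) * (δ ^ μ * T) := by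
    refine (le_abs_self _).trans ?_
    rw [abs_mul, abs_mul]
    calc |Q i j| * |u i| * |v j|
        ≤ (ψ i j * a ^ (γ - r i - r j)) * (m i * (a ^ (μ + r i) + z ^ (μ + r i)))
          * (m j * (a ^ (μ + r j) + b ^ (μ + r j))) := by
          gcongr
          exacts [hQ i j, hu i, hv j]
      _ = m j * (m i * ψ i j) * (a ^ (γ - r i - r j) * (a ^ (μ + r i) + z ^ (μ + r i))
          * (a ^ (μ + r j) + b ^ (μ + r j))) := by ring
      _ ≤ _ := by
          refine mul_le_mul_of_nonneg_left (rpow_mul_add_mul_add_le (A := γ - r i - r j) (B := μ + r i) (C := μ + r j)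
            (g := γ + μ) ha hb hz haδ hbδ hzδ (by linarith) (by linarith)
            (by linarith) (by linarith) hμ.le (by ring)) (by positivity)
  have hPterm : P i * G i j * v j ≤ m j * (β i * η i j *
      (if 0 ≤ μ + r i - r j then 1 else δ ^ (r j - r i - μ))) * (δ ^ μ * T) := by
    refine (le_abs_self _).trans ?_
    rw [abs_mul, abs_mul]
    split_ifs with he
    · calc |P i| * |G i j| * |v j|
          ≤ (β i * a ^ (γ - r i)) * (η i j * (a ^ (μ + r i - r j) + z ^ (μ + r i - r j)))
            * (m j * (a ^ (μ + r j) + b ^ (μ + r j))) := by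
            gcongr
            exacts [hP i, hG1 i j he, hv j]
        _ = m j * (β i * η i j * 1) * (a ^ (γ - r i) * (a ^ (μ + r i - r j) + z ^ (μ + r i - r j))
            * (a ^ (μ + r j) + b ^ (μ + r j))) := by ring
        _ ≤ _ := by
            refine mul_le_mul_of_nonneg_left (rpow_mul_add_mul_add_le (A := γ - r i) (B := μ + r i - r j) (C := μ + r j)
              (g := γ + μ) ha hb hz haδ hbδ hzδ (by linarith) he
              (by linarith) (by linarith) hμ.le (by ring)) (by positivity)
    · have he' : μ + r i - r j < 0 := not_le.1 he
      have hcore := rpow_mul_add_mul_add_le (A := γ - r i) (B := 0) (C := μ + r j) (g := γ + μ)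
        (d := r j - r i) ha hb hz haδ hbδ hzδ (by linarith) le_rfl
        (by linarith) (by linarith) (by linarith) (by ring)
      rw [Real.rpow_zero, Real.rpow_zero, ← hT] at hcore
      have hsplit : δ ^ (r j - r i) = δ ^ (r j - r i - μ) * δ ^ μ := by
        rw [← Real.rpow_add hδ]; ring_nf
      have hnn : 0 ≤ a ^ (γ - r i) * (a ^ (μ + r j) + b ^ (μ + r j)) := by positivity
      calc |P i| * |G i j| * |v j|
          ≤ (β i * a ^ (γ - r i)) * η i j * (m j * (a ^ (μ + r j) + b ^ (μ + r j))) := by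
            gcongr
            exacts [hP i, hG2 i j he', hv j]
        _ = m j * (β i * η i j) * (a ^ (γ - r i) * (a ^ (μ + r j) + b ^ (μ + r j))) := by ring
        _ ≤ m j * (β i * η i j) * (δ ^ (r j - r i) * T) := by
            exact mul_le_mul_of_nonneg_left (by linarith) (by positivity)
        _ = _ := by rw [hsplit]; ring
  calc P i * G i j * v j + Q i j * u i * v j ≤ _ := add_le_add hPterm hQterm
    _ = _ := by ring

open MeasureTheory in
theorem hasDerivAt_integral_moving_endpoint {E : Type*} [NormedAddCommGroup E] [NormedSpace ℝ E]
    [CompleteSpace E] {Ψ : ℝ → ℝ → E} (hΨ : Continuous Ψ.uncurry) (a t : ℝ) :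
    HasDerivAt (fun τ => ∫ s in a..(a + (τ - t)), Ψ τ s) (Ψ t a) t := by
  rw [hasDerivAt_iff_isLittleO, Asymptotics.isLittleO_iff]
  intro c hc
  obtain ⟨ε, hε, hball⟩ := Metric.continuous_iff.1 hΨ (t, a) c hc
  filter_upwards [Metric.ball_mem_nhds t hε] with τ hτ
  have hcont : Continuous (Ψ τ) := hΨ.comp (by fun_prop : Continuous fun s : ℝ => (τ, s))
  have heq : (∫ s in a..(a + (τ - t)), Ψ τ s) - (∫ s in a..(a + (t - t)), Ψ t s) - (τ - t) • Ψ t a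
      = ∫ s in a..(a + (τ - t)), (Ψ τ s - Ψ t a) := by
    rw [intervalIntegral.integral_sub (hcont.intervalIntegrable _ _) (by simp)]
    simp
  rw [heq]
  have := intervalIntegral.norm_integral_le_of_norm_le_const (a := a) (b := a + (τ - t)) (C := c)
    (f := fun s => Ψ τ s - Ψ t a) fun s hs => by
      have hs' : |s - a| ≤ |τ - t| := by
        rcases Set.mem_uIoc.1 hs with h | h
        · rw [abs_of_nonneg (by linarith), abs_of_nonneg (by linarith)]; linarith
        · rw [abs_of_nonpos (by linarith), abs_of_nonpos (by linarith)]; linarith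
      rw [Metric.mem_ball, Real.dist_eq] at hτ
      have := hball (τ, s) (by
        rw [Prod.dist_eq, max_lt_iff]
        exact ⟨hτ, hs'.trans_lt hτ⟩)
      rw [dist_eq_norm] at this
      exact this.le
  simpa [Real.norm_eq_abs] using this

open MeasureTheory Set in
theorem intervalIntegrable_fderiv_section {n : ℕ} {f : (Fin n → ℝ) → (Fin n → ℝ) → (Fin n → ℝ)}
    (hf : Continuous f.uncurry)
    (hbd : ∀ R : ℝ, ∃ K : ℝ, ∀ y ∈ Metric.closedBall (0 : Fin n → ℝ) R,
      ∀ z ∈ Metric.closedBall (0 : Fin n → ℝ) R, ‖fderiv ℝ (fun z => f z y) z‖ ≤ K)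
    {x : ℝ → Fin n → ℝ} (hx : Continuous x) (z : Fin n → ℝ) (a b : ℝ) :
    IntervalIntegrable (fun s => fderiv ℝ (fun z => f z (x s)) z) volume a b := by
  have hmeas : Measurable fun s => fderiv ℝ (fun z => f z (x s)) z := by
    have hswap : Continuous (Function.uncurry fun y z => f z y) :=
      hf.comp (by fun_prop : Continuous fun q : (Fin n → ℝ) × (Fin n → ℝ) => (q.2, q.1))
    exact (measurable_fderiv_with_param ℝ hswap).comp
      (by fun_prop : Measurable fun s => (x s, z))
  obtain ⟨C, hC⟩ := (isCompact_uIcc (a := a) (b := b)).exists_bound_of_continuousOn hx.continuousOn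
  obtain ⟨K, hK⟩ := hbd (max C ‖z‖)
  refine (intervalIntegrable_const (c := K)).mono_fun hmeas.aestronglyMeasurable ?_
  filter_upwards [ae_restrict_mem measurableSet_uIoc] with s hs
  refine (hK _ ?_ _ ?_).trans (le_abs_self K)
  · rw [mem_closedBall_zero_iff]; exact (hC s (uIoc_subset_uIcc hs)).trans (le_max_left _ _)
  · rw [mem_closedBall_zero_iff]; exact le_max_right _ _

open MeasureTheory Set in
theorem hasDerivWithinAt_delay_integral {n : ℕ}
    {f : (Fin n → ℝ) → (Fin n → ℝ) → (Fin n → ℝ)} (hf : Continuous f.uncurry)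
    (hd : ∀ y, Differentiable ℝ fun z => f z y)
    (hbd : ∀ R : ℝ, ∃ K : ℝ, ∀ y ∈ Metric.closedBall (0 : Fin n → ℝ) R,
      ∀ z ∈ Metric.closedBall (0 : Fin n → ℝ) R, ‖fderiv ℝ (fun z => f z y) z‖ ≤ K)
    {x : ℝ → Fin n → ℝ} (hx : Continuous x) {x' : Fin n → ℝ} {S : Set ℝ} {t : ℝ} (h : ℝ)
    (hxt : HasDerivWithinAt x x' S t) :
    HasDerivWithinAt (fun τ => ∫ s in (τ - h)..τ, f (x τ) (x s))
      ((∫ s in (t - h)..t, fderiv ℝ (fun z => f z (x s)) (x t) x')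
        + f (x t) (x t) - f (x t) (x (t - h))) S t := by
  have hΨ : Continuous (Function.uncurry fun τ s => f (x τ) (x s)) :=
    hf.comp (by fun_prop : Continuous fun q : ℝ × ℝ => (x q.1, x q.2))
  have hsec : ∀ z, Continuous fun s => f z (x s) := fun z =>
    hf.comp (by fun_prop : Continuous fun s => (z, x s))
  have hint := intervalIntegrable_fderiv_section hf hbd hx (x t) (t - h) t
  obtain ⟨C, hC⟩ :=
    (isCompact_uIcc (a := t - h) (b := t)).exists_bound_of_continuousOn hx.continuousOn
  obtain ⟨K, hK⟩ := hbd (max C (‖x t‖ + 1))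
  have hJ : HasFDerivAt (fun z => ∫ s in (t - h)..t, f z (x s))
      (∫ s in (t - h)..t, fderiv ℝ (fun z => f z (x s)) (x t)) (x t) := by
    refine intervalIntegral.hasFDerivAt_integral_of_dominated_of_fderiv_le
      (F' := fun z s => fderiv ℝ (fun z => f z (x s)) z) (bound := fun _ => K)
      (Metric.ball_mem_nhds (x t) one_pos)
      (Filter.Eventually.of_forall fun z => (hsec z).aestronglyMeasurable)
      ((hsec _).intervalIntegrable _ _) hint.def'.aestronglyMeasurable ?_
      intervalIntegrable_const ?_
    · refine Filter.Eventually.of_forall fun s hs z hz => hK _ ?_ _ ?_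
      · rw [mem_closedBall_zero_iff]; exact (hC s (uIoc_subset_uIcc hs)).trans (le_max_left _ _)
      · rw [mem_closedBall_zero_iff]
        rw [mem_ball_iff_norm] at hz
        have := norm_le_norm_add_norm_sub' z (x t)
        exact le_trans (by linarith) (le_max_right _ _)
    · exact Filter.Eventually.of_forall fun s _ z _ => ((hd (x s)) z).hasFDerivAt
  have h1 := hJ.comp_hasDerivWithinAt t hxt
  have h2 := (hasDerivAt_integral_moving_endpoint hΨ t t).hasDerivWithinAt (s := S)
  have h3 := (hasDerivAt_integral_moving_endpoint hΨ (t - h) t).hasDerivWithinAt (s := S)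
  have key := (h1.add h2).sub h3
  rw [ContinuousLinearMap.intervalIntegral_apply hint] at key
  refine (key.congr_deriv (by abel)).congr (fun τ _ => ?_) ?_ <;>
  · simp only [Pi.add_apply, Pi.sub_apply, Function.comp_apply]
    have hi : ∀ τ a b, IntervalIntegrable (fun s => f (x τ) (x s)) volume a b :=
      fun τ a b => (hsec _).intervalIntegrable a b
    rw [intervalIntegral.integral_add_adjacent_intervals (hi _ _ _) (hi _ _ _), add_sub_cancel,
      intervalIntegral.integral_interval_sub_left (hi _ _ _) (hi _ _ _)]
    congr 1
    ring

open MeasureTheory Set in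
theorem hasDerivAt_weighted_integral {N : ℝ → ℝ} (hN : Continuous N) (h w1 w2 t : ℝ) :
    HasDerivAt (fun τ => ∫ θ in (-h)..(0 : ℝ), (w1 + (h + θ) * w2) * N (τ + θ))
      ((w1 + h * w2) * N t - w1 * N (t - h) - w2 * ∫ θ in (-h)..(0 : ℝ), N (t + θ)) t := by
  have hprim : ∀ M : ℝ → ℝ, Continuous M →
      HasDerivAt (fun τ => ∫ s in (τ - h)..τ, M s) (M t - M (t - h)) t := by
    intro M hM
    have h1 : HasDerivAt (fun τ => ∫ s in (0 : ℝ)..τ, M s) (M t) t :=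
      intervalIntegral.integral_hasDerivAt_right (hM.intervalIntegrable _ _)
        hM.stronglyMeasurable.stronglyMeasurableAtFilter hM.continuousAt
    have h2 : HasDerivAt (fun τ => ∫ s in (0 : ℝ)..(τ - h), M s) (M (t - h)) t :=
      HasDerivAt.comp_sub_const t h
        (intervalIntegral.integral_hasDerivAt_right (hM.intervalIntegrable _ _)
          hM.stronglyMeasurable.stronglyMeasurableAtFilter hM.continuousAt)
    refine (h1.sub h2).congr_of_eventuallyEq (Filter.Eventually.of_forall fun τ => ?_)
    exact (intervalIntegral.integral_interval_sub_left (hM.intervalIntegrable _ _)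
      (hM.intervalIntegrable _ _)).symm
  have hshift : ∀ τ, (∫ θ in (-h)..(0 : ℝ), N (τ + θ)) = ∫ s in (τ - h)..τ, N s := fun τ => by
    rw [intervalIntegral.integral_comp_add_left, add_zero, sub_eq_add_neg]
  have hK := hprim (fun s => s * N s) (by fun_prop)
  have hcoef : HasDerivAt (fun τ : ℝ => w1 + (h - τ) * w2) (-w2) t := by
    simpa using (((hasDerivAt_id t).const_sub h).mul_const w2).const_add w1
  have key := (hcoef.mul (hprim N hN)).add (hK.const_mul w2)
  rw [hshift]
  refine (key.congr_deriv (by ring)).congr_of_eventuallyEq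
    (Filter.Eventually.of_forall fun τ => ?_)
  simp only [Pi.add_apply, Pi.mul_apply]
  rw [← intervalIntegral.integral_const_mul, ← intervalIntegral.integral_const_mul,
    ← intervalIntegral.integral_add (Continuous.intervalIntegrable (by fun_prop) _ _)
      (Continuous.intervalIntegrable (by fun_prop) _ _)]
  have := intervalIntegral.integral_comp_add_left (a := -h) (b := 0)
    (fun s => (w1 + (h - τ) * w2) * N s + w2 * (s * N s)) τ
  rw [add_zero, ← sub_eq_add_neg] at this
  rw [← this]
  refine intervalIntegral.integral_congr fun θ _ => ?_
  ring


theorem stmt4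
    (n : ℕ) (hn : 1 ≤ n) (r : Fin n → ℝ) (hr : ∀ i, 0 < r i) (p : ℝ) (hp : 1 ≤ p)
    (h μ : ℝ) (hh : 0 < h) (hμ : 0 < μ)
    (f : (Fin n → ℝ) → (Fin n → ℝ) → (Fin n → ℝ))
    (hf_cd : ∀ y : Fin n → ℝ, ContDiff ℝ 1 fun x => f x y)
    (hf_lip : ∀ x : Fin n → ℝ, LocallyLipschitz fun y => f x y)
    (hf_hom : ∀ ε : ℝ, 0 < ε → ∀ x y : Fin n → ℝ, ∀ i,
      f (fun k => ε ^ r k * x k) (fun k => ε ^ r k * y k) i = ε ^ (μ + r i) * f x y i)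
    (m : Fin n → ℝ) (hm : ∀ i, 0 < m i)
    (hfm : ∀ x y : Fin n → ℝ, ∀ i,
      |f x y i| ≤ m i * (hnorm n r p x ^ (μ + r i) + hnorm n r p y ^ (μ + r i)))
    (η : Fin n → Fin n → ℝ) (hη : ∀ i j, 0 < η i j)
    (hfd1 : ∀ i j, 0 ≤ μ + r i - r j → ∀ x y : Fin n → ℝ,
      |pd n f i j x y| ≤ η i j * (hnorm n r p x ^ (μ + r i - r j) + hnorm n r p y ^ (μ + r i - r j)))
    (hfd2 : ∀ i j, μ + r i - r j < 0 → ∀ x y : Fin n → ℝ, |pd n f i j x y| ≤ η i j)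
    (V : (Fin n → ℝ) → ℝ) (hV : ContDiff ℝ 2 V)
    (α0 α1 γ : ℝ) (hα0 : 0 < α0) (hα1 : 0 < α1) (hγ : ∀ i, 2 * r i ≤ γ)
    (hVlb : ∀ x : Fin n → ℝ, α0 * hnorm n r p x ^ γ ≤ V x)
    (hVub : ∀ x : Fin n → ℝ, V x ≤ α1 * hnorm n r p x ^ γ)
    (β : Fin n → ℝ) (hβ : ∀ i, 0 < β i)
    (hVd : ∀ x : Fin n → ℝ, ∀ i,
      |fderiv ℝ V x (Pi.single i 1)| ≤ β i * hnorm n r p x ^ (γ - r i))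
    (ψ : Fin n → Fin n → ℝ) (hψ : ∀ i j, 0 < ψ i j)
    (hVdd : ∀ x : Fin n → ℝ, ∀ i j,
      |fderiv ℝ (fun z => fderiv ℝ V z (Pi.single i 1)) x (Pi.single j 1)|
        ≤ ψ i j * hnorm n r p x ^ (γ - r i - r j))
    (w : ℝ) (hw : 0 < w)
    (hVf : ∀ x : Fin n → ℝ, fderiv ℝ V x (f x x) ≤ -w * hnorm n r p x ^ (γ + μ))
    (w1 w2 : ℝ) (hw1 : 0 < w1) (hw2 : 0 < w2) (hw0 : 0 < w - w1 - h * w2)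
    (δ : ℝ) (hδ0 : 0 < δ)
    (L : ℝ) (hLdef : L = ∑ i, ∑ j, m j * (β i * η i j *
      (if 0 ≤ μ + r i - r j then 1 else δ ^ (r j - r i - μ)) + m i * ψ i j))
    (H2 : ℝ) (hH2def : H2 = (min ((w - w1 - h * w2) / (4 * h * L))
      (min (w1 / (2 * h * L)) (w2 / (2 * L)))) ^ (1 / μ))
    (hδH2 : δ < H2)
    (c0 c1 c2 : ℝ)
    (hc0def : c0 = (w - w1 - h * w2) - 4 * h * L * δ ^ μ)
    (hc1def : c1 = w1 - 2 * h * L * δ ^ μ)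
    (hc2def : c2 = w2 - 2 * L * δ ^ μ) :
    0 < c0 ∧ 0 < c1 ∧ 0 < c2 ∧
    ∀ x : ℝ → Fin n → ℝ, IsSol n h f x → ∀ t : ℝ, 0 ≤ t →
      (∀ θ ∈ Set.Icc (-h) (0:ℝ), hnorm n r p (x (t + θ)) ≤ δ) →
      ∃ D : ℝ, HasDerivWithinAt (fun τ => vfun n r p h μ γ w1 w2 f V (fun θ => x (τ + θ))) D (Set.Ici 0) t ∧
        D ≤ -c0 * hnorm n r p (x t) ^ (γ + μ) - c1 * hnorm n r p (x (t - h)) ^ (γ + μ)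
          - c2 * ∫ θ in (-h)..(0:ℝ), hnorm n r p (x (t + θ)) ^ (γ + μ) := by
  have hL0 : 0 < L := by
    rw [hLdef]
    have : Nonempty (Fin n) := ⟨⟨0, hn⟩⟩
    refine Finset.sum_pos (fun i _ => Finset.sum_pos (fun j _ => ?_) Finset.univ_nonempty)
      Finset.univ_nonempty
    have := hm i
    have := hm j
    have := hβ i
    have := hη i j
    have := hψ i j
    split_ifs <;> positivity
  have hδμ : δ ^ μ < min ((w - w1 - h * w2) / (4 * h * L))
      (min (w1 / (2 * h * L)) (w2 / (2 * L))) := by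
    have := Real.rpow_lt_rpow hδ0.le hδH2 hμ
    rwa [hH2def, ← Real.rpow_mul (by positivity), one_div_mul_cancel hμ.ne', Real.rpow_one] at this
  rw [lt_min_iff, lt_min_iff, lt_div_iff₀ (by positivity), lt_div_iff₀ (by positivity),
    lt_div_iff₀ (by positivity)] at hδμ
  obtain ⟨hb0, hb1, hb2⟩ := hδμ
  refine ⟨by linarith, by linarith, by linarith, ?_⟩
  intro x hsol t ht hxδ
  have hp0 : 0 < p := by linarith
  have hγμ : 0 < γ + μ := by linarith [hγ ⟨0, hn⟩, hr ⟨0, hn⟩]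
  have hd : ∀ y, Differentiable ℝ fun z => f z y := fun y => (hf_cd y).differentiable one_ne_zero
  have hbd := exists_norm_fderiv_le_of_pd_le hr hp0 hd hfd1 hfd2
  have hfc : Continuous f.uncurry :=
    continuous_uncurry_of_norm_fderiv_le hd (fun z => (hf_lip z).continuous) hbd
  obtain ⟨y, hyc, hyx⟩ : ∃ y : ℝ → Fin n → ℝ, Continuous y ∧ ∀ s, -h ≤ s → y s = x s :=
    ⟨fun s => x (max s (-h)), hsol.1.comp_continuous (by fun_prop) fun s => Set.mem_Ici.2 (le_max_right s (-h)),
      fun s hs => by simp only [max_eq_left hs]⟩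
  have hyt : y t = x t := hyx t (by linarith)
  have hyth : y (t - h) = x (t - h) := hyx _ (by linarith)
  set v' := f (y t) (y (t - h)) with hv'
  have hyd : HasDerivWithinAt y v' (Set.Ici 0) t := by
    rw [hv', hyt, hyth]
    exact (hsol.2 t ht).congr (fun s hs => hyx s (by linarith [Set.mem_Ici.1 hs])) hyt
  have hN : Continuous fun s => hnorm n r p (y s) ^ (γ + μ) :=
    ((continuous_hnorm hr hp0).comp hyc).rpow_const fun _ => Or.inr hγμ.le
  have hVd1 : ∀ z, HasFDerivAt V (fderiv ℝ V z) z := fun z =>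
    (hV.differentiable two_ne_zero z).hasFDerivAt
  have hVd2 : ∀ z, HasFDerivAt (fderiv ℝ V) (fderiv ℝ (fderiv ℝ V) z) z := fun z =>
    (((hV.fderiv_right (m := 1) (by norm_num)).differentiable one_ne_zero) z).hasFDerivAt
  have hderiv := (((hVd1 (y t)).comp_hasDerivWithinAt t hyd).add
    (((hVd2 (y t)).comp_hasDerivWithinAt t hyd).clm_apply
      (hasDerivWithinAt_delay_integral hfc hd hbd hyc h hyd))).add
    (hasDerivAt_weighted_integral hN h w1 w2 t).hasDerivWithinAt
  have hvfun : ∀ τ ∈ Set.Ici (0 : ℝ), vfun n r p h μ γ w1 w2 f V (fun θ => x (τ + θ)) =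
      V (y τ) + fderiv ℝ V (y τ) (∫ s in (τ - h)..τ, f (y τ) (y s))
        + ∫ θ in (-h)..(0 : ℝ), (w1 + (h + θ) * w2) * hnorm n r p (y (τ + θ)) ^ (γ + μ) := by
    intro τ hτ
    have hτ0 : 0 ≤ τ := hτ
    have hxy : ∀ θ ∈ Set.uIcc (-h) 0, x (τ + θ) = y (τ + θ) := fun θ hθ => by
      rw [Set.uIcc_of_le (by linarith)] at hθ
      exact (hyx _ (by linarith [hθ.1])).symm
    have hshift : (∫ s in (τ - h)..τ, f (y τ) (y s)) = ∫ θ in (-h)..0, f (y τ) (y (τ + θ)) := by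
      rw [intervalIntegral.integral_comp_add_left (fun s => f (y τ) (y s)), add_zero,
        sub_eq_add_neg]
    rw [vfun, hshift, add_zero, ← hyx τ (by linarith)]
    congr 1
    · congr 2
      exact intervalIntegral.integral_congr fun θ hθ => by simp only [hxy θ hθ]
    · exact intervalIntegral.integral_congr fun θ hθ => by simp only [hxy θ hθ]
  refine ⟨_, hderiv.congr hvfun (hvfun t ht), ?_⟩
  have hshiftN : (∫ θ in (-h)..(0 : ℝ), hnorm n r p (x (t + θ)) ^ (γ + μ)) =
      ∫ s in (t - h)..t, hnorm n r p (y s) ^ (γ + μ) := by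
    have := intervalIntegral.integral_comp_add_left (a := -h) (b := 0)
      (fun s => hnorm n r p (y s) ^ (γ + μ)) t
    rw [add_zero, ← sub_eq_add_neg] at this
    rw [← this]
    refine intervalIntegral.integral_congr fun θ hθ => ?_
    rw [Set.uIcc_of_le (by linarith)] at hθ
    simp only [hyx (t + θ) (by linarith [hθ.1])]
  have hshiftN' : (∫ θ in (-h)..(0 : ℝ), hnorm n r p (y (t + θ)) ^ (γ + μ)) =
      ∫ s in (t - h)..t, hnorm n r p (y s) ^ (γ + μ) := by
    rw [intervalIntegral.integral_comp_add_left (fun s => hnorm n r p (y s) ^ (γ + μ)), add_zero,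
      sub_eq_add_neg]
  have hyδ : ∀ s ∈ Set.Icc (t - h) t, hnorm n r p (y s) ≤ δ := fun s hs => by
    have := hxδ (s - t) ⟨by linarith [hs.1], by linarith [hs.2]⟩
    rwa [add_sub_cancel, ← hyx s (by linarith [hs.1])] at this
  have hpoint : ∀ s ∈ Set.Icc (t - h) t,
      fderiv ℝ V (y t) (fderiv ℝ (fun z => f z (y s)) (y t) v')
        + fderiv ℝ (fderiv ℝ V) (y t) v' (f (y t) (y s)) ≤
      L * δ ^ μ * (4 * hnorm n r p (y t) ^ (γ + μ) + 2 * hnorm n r p (y (t - h)) ^ (γ + μ)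
        + 2 * hnorm n r p (y s) ^ (γ + μ)) := by
    intro s hs
    have hsum := sum_remainder_le hr hμ hγ hδ0 hm hβ hη hψ (hnorm_nonneg r p (y t))
      (hnorm_nonneg r p (y (t - h))) (hnorm_nonneg r p (y s)) (hyδ t ⟨by linarith, le_rfl⟩)
      (hyδ (t - h) ⟨le_rfl, by linarith⟩) (hyδ s hs) (hVd (y t))
      (fun i j he => hfd1 i j he (y t) (y s)) (fun i j he => hfd2 i j he (y t) (y s))
      (fun i => hfm (y t) (y s) i) (fun j => hfm (y t) (y (t - h)) j) (hVdd (y t))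
    rw [← hLdef] at hsum
    refine le_trans (le_of_eq ?_) hsum
    simp only [Finset.sum_add_distrib]
    congr 1
    · rw [clm_apply_eq_sum]
      refine Finset.sum_congr rfl fun i _ => ?_
      have := clm_apply_eq_sum
        ((ContinuousLinearMap.proj i).comp (fderiv ℝ (fun z => f z (y s)) (y t))) v'
      simp only [ContinuousLinearMap.comp_apply, ContinuousLinearMap.proj_apply] at this
      rw [this, Finset.sum_mul]
      refine Finset.sum_congr rfl fun j _ => ?_
      rw [pd_eq_fderiv (hd (y s) (y t))]
      ring
    · rw [clm_apply_eq_sum]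
      refine Finset.sum_congr rfl fun i _ => ?_
      have := clm_apply_eq_sum ((fderiv ℝ (fderiv ℝ V) (y t)).flip (Pi.single i 1)) v'
      simp only [ContinuousLinearMap.flip_apply] at this
      rw [this, Finset.mul_sum]
      refine Finset.sum_congr rfl fun j _ => ?_
      have hQ : fderiv ℝ (fun z => fderiv ℝ V z (Pi.single i 1)) (y t) (Pi.single j 1) =
          fderiv ℝ (fderiv ℝ V) (y t) (Pi.single j 1) (Pi.single i 1) := by
        rw [((hVd2 (y t)).clm_apply (hasFDerivAt_const (Pi.single i (1 : ℝ)) (y t))).fderiv]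
        simp
      rw [hQ]
      ring
  have hA := intervalIntegrable_fderiv_section hfc hbd hyc (y t) (t - h) t
  have hAv : IntervalIntegrable (fun s => fderiv ℝ (fun z => f z (y s)) (y t) v')
      MeasureTheory.volume (t - h) t :=
    ⟨(ContinuousLinearMap.apply ℝ (Fin n → ℝ) v').integrable_comp hA.1,
      (ContinuousLinearMap.apply ℝ (Fin n → ℝ) v').integrable_comp hA.2⟩
  have hB : IntervalIntegrable (fun s => f (y t) (y s)) MeasureTheory.volume (t - h) t :=
    (hfc.comp (by fun_prop : Continuous fun s => (y t, y s))).intervalIntegrable _ _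
  have hVA := (fderiv ℝ V (y t)).intervalIntegral_comp_comm hAv
  have hHB := (fderiv ℝ (fderiv ℝ V) (y t) v').intervalIntegral_comp_comm hB
  have hVAi : IntervalIntegrable
      (fun s => fderiv ℝ V (y t) (fderiv ℝ (fun z => f z (y s)) (y t) v'))
      MeasureTheory.volume (t - h) t := ⟨(fderiv ℝ V (y t)).integrable_comp hAv.1,
    (fderiv ℝ V (y t)).integrable_comp hAv.2⟩
  have hHBi : IntervalIntegrable (fun s => fderiv ℝ (fderiv ℝ V) (y t) v' (f (y t) (y s)))
      MeasureTheory.volume (t - h) t :=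
    ⟨(fderiv ℝ (fderiv ℝ V) (y t) v').integrable_comp hB.1,
      (fderiv ℝ (fderiv ℝ V) (y t) v').integrable_comp hB.2⟩
  have hmono := intervalIntegral.integral_mono_on (by linarith) (hVAi.add hHBi)
    (Continuous.intervalIntegrable (by fun_prop) _ _) hpoint
  rw [intervalIntegral.integral_add hVAi hHBi, hVA, hHB, intervalIntegral.integral_const_mul,
    intervalIntegral.integral_add intervalIntegrable_const
      (Continuous.intervalIntegrable (by fun_prop) _ _),
    intervalIntegral.integral_const, intervalIntegral.integral_const_mul, smul_eq_mul,
    sub_sub_cancel] at hmono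
  have hVft := hVf (y t)
  rw [hshiftN, hshiftN', ← hyt, ← hyth, map_sub, map_add, ← hv', hc0def, hc1def, hc2def]
  simp only [Function.comp_apply]
  linarith
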